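/- Permanent-determinant cumulant identity: let G be an n×n symmetric real matrix. Define for finite A ⊂ [n]: k_perm(A) = Σ_{π∈Π(A)} (|π|−1)!(−1)^{|π|−1} ∏_{B∈π} perm(G_{BB}) and k_det(A) = Σ_{π∈Π(A)} (|π|−1)!(−1)^{|π|−1} ∏_{B∈π} det(G_{BB}). Then k_perm(A) = (−1)^{|A|−1} k_det(A) for every A, and k_perm(A) = Σ_{σ cyclic on A} ∏_{i∈A} G(i,σ(i)). -/

import Mathlib

open scoped BigOperators Classical

/-- The permanent of a square matrix. -/
noncomputable def permanent {ι : Type*} [Fintype ι] [DecidableEq ι]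
    (M : Matrix ι ι ℝ) : ℝ :=
  ∑ σ : Equiv.Perm ι, ∏ i, M i (σ i)

/-- The set partitions of a finite set `A`. -/
noncomputable def finsetPartitions {n : ℕ} (A : Finset (Fin n)) :
    Finset (Finset (Finset (Fin n))) :=
  A.powerset.powerset.filter fun π =>
    (∀ B ∈ π, B.Nonempty) ∧ (∀ B ∈ π, ∀ C ∈ π, B ≠ C → Disjoint B C) ∧
      π.sup id = A

/-- The cumulant function of the permanents of principal submatrices. -/
noncomputable def kPerm {n : ℕ} (G : Matrix (Fin n) (Fin n) ℝ)
    (A : Finset (Fin n)) : ℝ :=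
  ∑ π ∈ finsetPartitions A,
    ((π.card - 1).factorial : ℝ) * (-1 : ℝ) ^ (π.card - 1) *
      ∏ B ∈ π, permanent (G.submatrix (fun a : {x // x ∈ B} => (a : Fin n))
        (fun a : {x // x ∈ B} => (a : Fin n)))

/-- The cumulant function of the determinants of principal submatrices. -/
noncomputable def kDet {n : ℕ} (G : Matrix (Fin n) (Fin n) ℝ)
    (A : Finset (Fin n)) : ℝ :=
  ∑ π ∈ finsetPartitions A,
    ((π.card - 1).factorial : ℝ) * (-1 : ℝ) ^ (π.card - 1) *
      ∏ B ∈ π, (G.submatrix (fun a : {x // x ∈ B} => (a : Fin n))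
        (fun a : {x // x ∈ B} => (a : Fin n))).det

noncomputable def muC (k : ℕ) : ℝ := ((k - 1).factorial : ℝ) * (-1 : ℝ) ^ (k - 1)

lemma muC_succ (m : ℕ) (hm : 0 < m) : muC (m + 1) + (m : ℝ) * muC m = 0 := by
  obtain ⟨k, rfl⟩ : ∃ k, m = k + 1 := ⟨m - 1, by omega⟩
  simp only [muC, Nat.add_sub_cancel, Nat.factorial_succ]
  push_cast
  ring

lemma mem_fp {n : ℕ} {A : Finset (Fin n)} {π : Finset (Finset (Fin n))} :
    π ∈ finsetPartitions A ↔ (∀ B ∈ π, B.Nonempty) ∧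
      (∀ B ∈ π, ∀ C ∈ π, ∀ x, x ∈ B → x ∈ C → B = C) ∧
      (∀ x, x ∈ A ↔ ∃ B ∈ π, x ∈ B) := by
  have hd : (∀ B ∈ π, ∀ C ∈ π, B ≠ C → Disjoint B C) ↔
      (∀ B ∈ π, ∀ C ∈ π, ∀ x, x ∈ B → x ∈ C → B = C) := by
    constructor
    · intro h B hB C hC x hx hx'
      by_contra hne
      exact Finset.disjoint_left.1 (h B hB C hC hne) hx hx'
    · intro h B hB C hC hne
      exact Finset.disjoint_left.2 fun x hx hx' => hne (h B hB C hC x hx hx')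
  have hs : π.sup id = A ↔ (∀ x, x ∈ A ↔ ∃ B ∈ π, x ∈ B) := by
    rw [Finset.ext_iff]
    refine forall_congr' fun x => ?_
    rw [Finset.mem_sup]
    simp only [id]
    exact ⟨fun h => h.symm, fun h => h.symm⟩
  unfold finsetPartitions
  rw [Finset.mem_filter, hd, hs]
  constructor
  · exact fun h => h.2
  · intro h
    refine ⟨?_, h⟩
    rw [Finset.mem_powerset]
    intro B hB
    rw [Finset.mem_powerset]
    intro x hx
    exact (h.2.2 x).2 ⟨B, hB, hx⟩

/-- invariant partitions of `A` minus `O` give those of `A` having `O` as a block -/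
lemma sum_S1 {n : ℕ} (inv : Finset (Fin n) → Prop) (A O : Finset (Fin n))
    (hOA : O ⊆ A) (hO : O.Nonempty) (hiO : inv O) :
    ∑ π ∈ (finsetPartitions A).filter (fun π => (∀ B ∈ π, inv B) ∧ O ∈ π), muC π.card =
    ∑ ρ ∈ (finsetPartitions (A \ O)).filter (fun π => (∀ B ∈ π, inv B)), muC (ρ.card + 1) := by
  symm
  have key : ∀ ρ ∈ finsetPartitions (A \ O), O ∉ ρ := by
    intro ρ hρ h
    obtain ⟨x, hx⟩ := hO
    have := ((mem_fp.1 hρ).2.2 x).2 ⟨O, h, hx⟩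
    simp [hx] at this
  refine Finset.sum_bij' (fun ρ _ => insert O ρ) (fun π _ => π.erase O) ?_ ?_ ?_ ?_ ?_
  · intro ρ hρ
    rw [Finset.mem_filter] at hρ ⊢
    obtain ⟨h1, h2⟩ := hρ
    have h1' := mem_fp.1 h1
    obtain ⟨a, b, c⟩ := h1'
    have c' : ∀ B ∈ ρ, ∀ x ∈ B, x ∈ A ∧ x ∉ O := fun B hB x hx =>
      Finset.mem_sdiff.1 ((c x).2 ⟨B, hB, hx⟩)
    refine ⟨mem_fp.2 ⟨?_, ?_, ?_⟩, ?_, ?_⟩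
    · grind
    · grind
    · intro x
      have := c x
      grind
    · grind
    · grind
  · intro π hπ
    rw [Finset.mem_filter] at hπ ⊢
    obtain ⟨h1, h2, h3⟩ := hπ
    obtain ⟨a, b, c⟩ := mem_fp.1 h1
    refine ⟨mem_fp.2 ⟨?_, ?_, ?_⟩, ?_⟩
    · grind
    · grind
    · intro x
      have := c x
      grind
    · grind
  · intro ρ hρ
    exact Finset.erase_insert (key ρ (Finset.mem_filter.1 hρ).1)
  · intro π hπ
    exact Finset.insert_erase (Finset.mem_filter.1 hπ).2.2
  · intro ρ hρ
    rw [Finset.card_insert_of_notMem (key ρ (Finset.mem_filter.1 hρ).1)]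

lemma sum_S2 {n : ℕ} (inv : Finset (Fin n) → Prop) (A O : Finset (Fin n))
    (hOA : O ⊆ A) (x₀ : Fin n) (hx₀ : x₀ ∈ O)
    (hU : ∀ B, inv B → inv (B ∪ O)) (hD : ∀ B, inv B → inv (B \ O))
    (hc : ∀ B, inv B → x₀ ∈ B → O ⊆ B) :
    ∑ π ∈ (finsetPartitions A).filter (fun π => (∀ B ∈ π, inv B) ∧ O ∉ π), muC π.card =
    ∑ ρ ∈ (finsetPartitions (A \ O)).filter (fun π => (∀ B ∈ π, inv B)),
      (ρ.card : ℝ) * muC ρ.card := by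
  have e1 : ∀ ρ : Finset (Finset (Fin n)), (ρ.card : ℝ) * muC ρ.card = ∑ C ∈ ρ, muC ρ.card := by
    intro ρ; rw [Finset.sum_const, nsmul_eq_mul]
  simp_rw [e1]
  rw [Finset.sum_sigma']
  symm
  refine Finset.sum_bij (fun (p : (_ : Finset (Finset (Fin n))) × Finset (Fin n)) _ =>
    insert (p.2 ∪ O) (p.1.erase p.2)) ?_ ?_ ?_ ?_
  · rintro ⟨ρ, C⟩ hp
    rw [Finset.mem_sigma, Finset.mem_filter] at hp
    obtain ⟨⟨h1, h2⟩, hC⟩ := hp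
    dsimp only at h1 h2 hC ⊢
    obtain ⟨a, b, c⟩ := mem_fp.1 h1
    have c' : ∀ B ∈ ρ, ∀ x ∈ B, x ∈ A ∧ x ∉ O := fun B hB x hx =>
      Finset.mem_sdiff.1 ((c x).2 ⟨B, hB, hx⟩)
    rw [Finset.mem_filter]
    refine ⟨mem_fp.2 ⟨?_, ?_, ?_⟩, ?_, ?_⟩
    · grind
    · grind
    · intro x
      have := c x
      constructor
      · intro hx
        by_cases hxO : x ∈ O
        · exact ⟨C ∪ O, by simp, by simp [hxO]⟩
        · obtain ⟨B, hB, hxB⟩ := this.1 (by simp [hx, hxO])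
          by_cases hBC : B = C
          · exact ⟨C ∪ O, by simp, by simp [← hBC, hxB]⟩
          · exact ⟨B, by simp [hBC, hB], hxB⟩
      · grind
    · grind
    · intro h
      obtain ⟨z, hz⟩ := a C hC
      rcases Finset.mem_insert.1 h with h | h
      · have : z ∈ O := by rw [h]; simp [hz]
        exact (c' C hC z hz).2 this
      · exact (c' O (Finset.mem_of_mem_erase h) x₀ hx₀).2 hx₀
  · rintro ⟨ρ, C⟩ hp ⟨ρ', C'⟩ hp' heq
    rw [Finset.mem_sigma, Finset.mem_filter] at hp hp'
    obtain ⟨⟨h1, h2⟩, hC⟩ := hp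
    obtain ⟨⟨h1', h2'⟩, hC'⟩ := hp'
    dsimp only at h1 h2 hC h1' h2' hC' heq
    obtain ⟨-, -, c⟩ := mem_fp.1 h1
    obtain ⟨-, -, d⟩ := mem_fp.1 h1'
    have c' : ∀ B ∈ ρ, ∀ x ∈ B, x ∈ A ∧ x ∉ O := fun B hB x hx =>
      Finset.mem_sdiff.1 ((c x).2 ⟨B, hB, hx⟩)
    have d' : ∀ B ∈ ρ', ∀ x ∈ B, x ∈ A ∧ x ∉ O := fun B hB x hx =>
      Finset.mem_sdiff.1 ((d x).2 ⟨B, hB, hx⟩)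
    have hCO : C ∪ O = C' ∪ O := by
      have : C ∪ O ∈ insert (C' ∪ O) (ρ'.erase C') := by rw [← heq]; simp
      rcases Finset.mem_insert.1 this with h | h
      · exact h
      · exact absurd hx₀ (d' _ (Finset.mem_of_mem_erase h) x₀ (by simp [hx₀])).2
    have hCC : C = C' := by
      ext z
      have hz : z ∈ C ∪ O ↔ z ∈ C' ∪ O := by rw [hCO]
      have h3 := c' C hC z
      have h4 := d' C' hC' z
      simp only [Finset.mem_union] at hz
      tauto
    subst hCC
    have n1 : C ∪ O ∉ ρ.erase C := fun h =>
      (c' _ (Finset.mem_of_mem_erase h) x₀ (by simp [hx₀])).2 hx₀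
    have n2 : C ∪ O ∉ ρ'.erase C := fun h =>
      (d' _ (Finset.mem_of_mem_erase h) x₀ (by simp [hx₀])).2 hx₀
    have h5 : ρ.erase C = ρ'.erase C := by
      rw [← Finset.erase_insert n1, heq, Finset.erase_insert n2]
    have : ρ = ρ' := by
      rw [← Finset.insert_erase hC, h5, Finset.insert_erase hC']
    subst this
    rfl
  · intro π hπ
    rw [Finset.mem_filter] at hπ
    obtain ⟨h1, h2, h3⟩ := hπ
    obtain ⟨a, b, c⟩ := mem_fp.1 h1
    obtain ⟨D, hDπ, hxD⟩ := (c x₀).1 (hOA hx₀)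
    have hOD := hc D (h2 D hDπ) hxD
    have hDO : D ≠ O := fun h => h3 (h ▸ hDπ)
    have hne : (D \ O).Nonempty := by
      rw [Finset.sdiff_nonempty]
      exact fun h => hDO (Finset.Subset.antisymm h hOD)
    have hnot : D \ O ∉ π.erase D := by
      intro h
      obtain ⟨z, hz⟩ := hne
      have := b _ (Finset.mem_of_mem_erase h) D hDπ z hz (Finset.mem_sdiff.1 hz).1
      exact Finset.ne_of_mem_erase h this
    refine ⟨⟨insert (D \ O) (π.erase D), D \ O⟩, ?_, ?_⟩
    · rw [Finset.mem_sigma, Finset.mem_filter]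
      refine ⟨⟨mem_fp.2 ⟨?_, ?_, ?_⟩, ?_⟩, by simp⟩
      · grind
      · grind
      · intro x
        dsimp only
        constructor
        · intro hx
          rw [Finset.mem_sdiff] at hx
          obtain ⟨B, hB, hxB⟩ := (c x).1 hx.1
          by_cases hBD : B = D
          · exact ⟨D \ O, by simp, by simp [← hBD, hxB, hx.2]⟩
          · exact ⟨B, by simp [hBD, hB], hxB⟩
        · rintro ⟨B, hB, hxB⟩
          rw [Finset.mem_sdiff, c x]
          rcases Finset.mem_insert.1 hB with h | h
          · subst h
            rw [Finset.mem_sdiff] at hxB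
            exact ⟨⟨D, hDπ, hxB.1⟩, hxB.2⟩
          · refine ⟨⟨B, Finset.mem_of_mem_erase h, hxB⟩, fun hxO => ?_⟩
            exact Finset.ne_of_mem_erase h
              (b _ (Finset.mem_of_mem_erase h) D hDπ x hxB (hOD hxO))
      · grind
    · dsimp only
      rw [Finset.erase_insert hnot, Finset.sdiff_union_of_subset hOD, Finset.insert_erase hDπ]
  · rintro ⟨ρ, C⟩ hp
    rw [Finset.mem_sigma, Finset.mem_filter] at hp
    obtain ⟨⟨h1, h2⟩, hC⟩ := hp
    dsimp only at h1 h2 hC ⊢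
    obtain ⟨-, -, c⟩ := mem_fp.1 h1
    have n1 : C ∪ O ∉ ρ.erase C := fun h =>
      (Finset.mem_sdiff.1 ((c x₀).2 ⟨_, Finset.mem_of_mem_erase h, by simp [hx₀]⟩)).2 hx₀
    rw [Finset.card_insert_of_notMem n1, Finset.card_erase_add_one hC]

lemma sum_zero {n : ℕ} (inv : Finset (Fin n) → Prop) (A O : Finset (Fin n))
    (hOA : O ⊆ A) (hne : O ≠ A) (x₀ : Fin n) (hx₀ : x₀ ∈ O) (hiO : inv O)
    (hU : ∀ B, inv B → inv (B ∪ O)) (hD : ∀ B, inv B → inv (B \ O))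
    (hc : ∀ B, inv B → x₀ ∈ B → O ⊆ B) :
    ∑ π ∈ (finsetPartitions A).filter (fun π => (∀ B ∈ π, inv B)), muC π.card = 0 := by
  rw [← Finset.sum_filter_add_sum_filter_not _ (fun π => O ∈ π), Finset.filter_filter,
    Finset.filter_filter, sum_S1 inv A O hOA ⟨x₀, hx₀⟩ hiO, sum_S2 inv A O hOA x₀ hx₀ hU hD hc,
    ← Finset.sum_add_distrib]
  refine Finset.sum_eq_zero fun ρ hρ => muC_succ _ ?_
  obtain ⟨-, -, c⟩ := mem_fp.1 (Finset.mem_filter.1 hρ).1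
  have : (A \ O).Nonempty := by
    rw [Finset.sdiff_nonempty]
    exact fun h => hne (Finset.Subset.antisymm hOA h)
  obtain ⟨z, hz⟩ := this
  obtain ⟨B, hB, -⟩ := (c z).1 hz
  exact Finset.card_pos.2 ⟨B, hB⟩

lemma blk_inv_pow {n : ℕ} {σ : Equiv.Perm (Fin n)} {B : Finset (Fin n)}
    (h : ∀ x ∈ B, σ x ∈ B) (m : ℕ) : ∀ x ∈ B, (σ ^ m) x ∈ B := by
  induction m with
  | zero => simp
  | succ k ih =>
    intro x hx
    rw [pow_succ']
    exact h _ (ih x hx)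

lemma inv_sc {n : ℕ} {σ : Equiv.Perm (Fin n)} {B : Finset (Fin n)}
    (h : ∀ x ∈ B, σ x ∈ B) {x y : Fin n} (hx : x ∈ B) (hxy : σ.SameCycle x y) : y ∈ B := by
  obtain ⟨m, -, hm⟩ := hxy.exists_pow_eq'
  rw [← hm]
  exact blk_inv_pow h m x hx

lemma inner_cum_sum {n : ℕ} (A : Finset (Fin n)) (σ : Equiv.Perm (Fin n)) (hσ : ∀ x ∈ A, σ x ∈ A) :
    ∑ π ∈ (finsetPartitions A).filter (fun π => (∀ B ∈ π, ∀ x ∈ B, σ x ∈ B)), muC π.card =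
      if (∀ x ∈ A, ∀ y ∈ A, σ.SameCycle x y) then 1 else 0 := by
  split_ifs with h
  · rcases A.eq_empty_or_nonempty with rfl | ⟨a, ha⟩
    · have : (finsetPartitions (∅ : Finset (Fin n))).filter
        (fun π => (∀ B ∈ π, ∀ x ∈ B, σ x ∈ B)) = {∅} := by
        ext π
        rw [Finset.mem_filter, mem_fp, Finset.mem_singleton]
        constructor
        · rintro ⟨⟨a, b, c⟩, -⟩
          rw [Finset.eq_empty_iff_forall_notMem]
          intro B hB
          obtain ⟨x, hx⟩ := a B hB
          exact Finset.notMem_empty x ((c x).2 ⟨B, hB, hx⟩)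
        · rintro rfl
          simp
      rw [this]
      simp [muC]
    · have : (finsetPartitions A).filter
        (fun π => (∀ B ∈ π, ∀ x ∈ B, σ x ∈ B)) = {{A}} := by
        ext π
        rw [Finset.mem_filter, mem_fp, Finset.mem_singleton]
        constructor
        · rintro ⟨⟨h1, h2, c⟩, h3⟩
          have hB : ∀ B ∈ π, B = A := by
            intro B hB
            obtain ⟨x, hx⟩ := h1 B hB
            have hxA := (c x).2 ⟨B, hB, hx⟩
            refine Finset.Subset.antisymm (fun y hy => (c y).2 ⟨B, hB, hy⟩) fun y hy => ?_
            exact inv_sc (h3 B hB) hx (h x hxA y hy)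
          obtain ⟨B, hBπ, -⟩ := (c a).1 ha
          ext C
          rw [Finset.mem_singleton]
          refine ⟨hB C, ?_⟩
          rintro rfl
          rw [← hB B hBπ]
          exact hBπ
        · rintro rfl
          refine ⟨⟨?_, ?_, ?_⟩, ?_⟩
          · simpa using ⟨a, ha⟩
          · simp
          · simp
          · simpa using hσ
      rw [this]
      simp [muC]
  · push Not at h
    obtain ⟨x, hx, y, hy, hxy⟩ := h
    have hO : ∀ z, z ∈ A.filter (fun z => σ.SameCycle x z) ↔ σ.SameCycle x z := by
      intro z
      rw [Finset.mem_filter]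
      exact ⟨fun h => h.2, fun h => ⟨inv_sc hσ hx h, h⟩⟩
    have hOA := Finset.filter_subset (fun z => σ.SameCycle x z) A
    generalize A.filter (fun z => σ.SameCycle x z) = O at hO hOA
    have hz := sum_zero (fun B => ∀ x ∈ B, σ x ∈ B) A O hOA ?_ x ?_ ?_ ?_ ?_ ?_
    · rw [← hz]
      refine Finset.sum_congr ?_ fun _ _ => rfl
      ext π
      simp only [Finset.mem_filter]
    · intro h
      rw [← h, hO] at hy
      exact hxy hy
    · exact (hO x).2 (Equiv.Perm.SameCycle.refl σ x)
    · intro z hz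
      rw [hO] at hz ⊢
      exact Equiv.Perm.sameCycle_apply_right.2 hz
    · intro B hB z hz
      rw [Finset.mem_union, hO] at hz ⊢
      exact hz.imp (hB z) Equiv.Perm.sameCycle_apply_right.2
    · intro B hB z hz
      rw [Finset.mem_sdiff, hO] at hz ⊢
      exact ⟨hB z hz.1, fun h => hz.2 (Equiv.Perm.sameCycle_apply_right.1 h)⟩
    · intro B hB hxB z hz
      rw [hO] at hz
      exact inv_sc hB hxB hz

/-- signed permanent over `B`, as a sum over permutations of `Fin n` fixing the complement -/
noncomputable def FF {n : ℕ} (ε : Equiv.Perm (Fin n) →* ℝ) (G : Matrix (Fin n) (Fin n) ℝ)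
    (B : Finset (Fin n)) : ℝ :=
  ∑ σ ∈ Finset.univ.filter (fun σ : Equiv.Perm (Fin n) => ∀ x, x ∉ B → σ x = x),
    ε σ * ∏ i ∈ B, G i (σ i)

lemma fix_inv {n : ℕ} {σ : Equiv.Perm (Fin n)} {B : Finset (Fin n)}
    (h : ∀ x, x ∉ B → σ x = x) : ∀ x ∈ B, σ x ∈ B := by
  intro x hx
  by_contra hn
  have := σ.injective (h _ hn)
  rw [this] at hn
  exact hn hx

lemma prod_FF {n : ℕ} (ε : Equiv.Perm (Fin n) →* ℝ) (G : Matrix (Fin n) (Fin n) ℝ)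
    (π : Finset (Finset (Fin n))) :
    (∀ B ∈ π, ∀ C ∈ π, B ≠ C → Disjoint B C) →
    ∏ B ∈ π, FF ε G B =
      ∑ σ ∈ Finset.univ.filter (fun σ : Equiv.Perm (Fin n) =>
        (∀ x, x ∉ π.sup id → σ x = x) ∧ ∀ B ∈ π, ∀ x ∈ B, σ x ∈ B),
        ε σ * ∏ i ∈ π.sup id, G i (σ i) := by
  induction π using Finset.induction_on with
  | empty =>
    intro _
    have : Finset.univ.filter (fun σ : Equiv.Perm (Fin n) =>
        (∀ x, x ∉ (∅ : Finset (Finset (Fin n))).sup id → σ x = x) ∧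
          ∀ B ∈ (∅ : Finset (Finset (Fin n))), ∀ x ∈ B, σ x ∈ B) = {1} := by
      ext σ
      simp [Equiv.ext_iff]
    rw [this]
    simp
  | insert B π hB ih =>
    intro hd
    have hd' : ∀ C ∈ π, Disjoint B C := fun C hC =>
      hd B (by simp) C (by simp [hC]) (fun h => hB (h ▸ hC))
    have hBS : Disjoint B (π.sup id) := by
      rw [Finset.disjoint_sup_right]
      exact hd'
    have hdl := Finset.disjoint_left.1 hBS
    rw [Finset.prod_insert hB, ih (fun C hC D hD => hd C (by simp [hC]) D (by simp [hD])), FF,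
      Finset.sum_mul_sum, ← Finset.sum_product', Finset.sup_insert]
    simp only [id, Finset.sup_eq_union]
    have hsub : ∀ C ∈ π, ∀ x ∈ C, x ∈ π.sup id := fun C hC x hx =>
      Finset.mem_sup.2 ⟨C, hC, hx⟩
    set S := π.sup id with hS
    clear_value S
    refine Finset.sum_bij (fun p _ => p.1 * p.2) ?_ ?_ ?_ ?_
    · rintro ⟨σ, τ⟩ hp
      simp only [Finset.mem_product, Finset.mem_filter, Finset.mem_univ, true_and] at hp ⊢
      obtain ⟨h1, h2, h3⟩ := hp
      refine ⟨?_, ?_⟩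
      · intro x hx
        rw [Finset.mem_union, not_or] at hx
        rw [Equiv.Perm.mul_apply, h2 x hx.2, h1 x hx.1]
      · intro C hC x hx
        rw [Equiv.Perm.mul_apply]
        rcases Finset.mem_insert.1 hC with rfl | hC
        · rw [h2 x (hdl hx)]
          exact fix_inv h1 x hx
        · have := h3 C hC x hx
          rw [h1 _ (fun hb => hdl hb (hsub C hC _ this))]
          exact this
    · rintro ⟨σ, τ⟩ hp ⟨σ', τ'⟩ hp' heq
      simp only [Finset.mem_product, Finset.mem_filter, Finset.mem_univ, true_and] at hp hp' heq
      obtain ⟨h1, h2, h3⟩ := hp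
      obtain ⟨h1', h2', h3'⟩ := hp'
      have : σ = σ' := by
        ext1 x
        by_cases hx : x ∈ B
        · have := congrArg (fun f : Equiv.Perm (Fin n) => f x) heq
          simpa [Equiv.Perm.mul_apply, h2 x (hdl hx), h2' x (hdl hx)] using this
        · rw [h1 x hx, h1' x hx]
      subst this
      rw [mul_left_cancel heq]
    · intro ρ hρ
      simp only [Finset.mem_filter, Finset.mem_univ, true_and] at hρ
      obtain ⟨h1, h2⟩ := hρ
      have hinv : ∀ x, ρ x ∈ B ↔ x ∈ B := by
        intro x
        refine ⟨fun h => ?_, h2 B (by simp) x⟩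
        exact inv_sc (h2 B (by simp)) h (Equiv.Perm.sameCycle_apply_left.2 (Equiv.Perm.SameCycle.refl _ _))
      have a1 : ∀ x ∈ B, Equiv.Perm.ofSubtype (ρ.subtypePerm hinv) x = ρ x := by
        intro x hx
        rw [Equiv.Perm.ofSubtype_apply_of_mem _ hx]
        rfl
      have a2 : ∀ x, x ∉ B → Equiv.Perm.ofSubtype (ρ.subtypePerm hinv) x = x := by
        intro x hx
        exact Equiv.Perm.ofSubtype_apply_of_not_mem _ hx
      set σ := Equiv.Perm.ofSubtype (ρ.subtypePerm hinv) with hσ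
      clear_value σ
      have b1 : ∀ x ∈ B, (σ⁻¹ * ρ) x = x := by
        intro x hx
        rw [Equiv.Perm.mul_apply, Equiv.Perm.inv_eq_iff_eq, a1 x hx]
      have b2 : ∀ x, x ∉ B → (σ⁻¹ * ρ) x = ρ x := by
        intro x hx
        rw [Equiv.Perm.mul_apply, Equiv.Perm.inv_eq_iff_eq, a2]
        rwa [hinv]
      refine ⟨(σ, σ⁻¹ * ρ), ?_, by simp⟩
      simp only [Finset.mem_product, Finset.mem_filter, Finset.mem_univ, true_and]
      refine ⟨a2, ?_, ?_⟩
      · intro x hx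
        by_cases hxB : x ∈ B
        · exact b1 x hxB
        · rw [b2 x hxB]
          exact h1 x (by simp [hx, hxB])
      · intro C hC x hx
        rw [b2 x (fun hb => hdl hb (hsub C hC x hx))]
        exact h2 C (by simp [hC]) x hx
    · rintro ⟨σ, τ⟩ hp
      simp only [Finset.mem_product, Finset.mem_filter, Finset.mem_univ, true_and] at hp ⊢
      obtain ⟨h1, h2, h3⟩ := hp
      rw [Finset.prod_union hBS, map_mul]
      have e1 : ∏ i ∈ B, G i ((σ * τ) i) = ∏ i ∈ B, G i (σ i) := by
        refine Finset.prod_congr rfl fun i hi => ?_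
        rw [Equiv.Perm.mul_apply, h2 i (hdl hi)]
      have e2 : ∏ i ∈ S, G i ((σ * τ) i) = ∏ i ∈ S, G i (τ i) := by
        refine Finset.prod_congr rfl fun i hi => ?_
        rw [Equiv.Perm.mul_apply, h1 (τ i) (fun hb => hdl hb (fix_inv h2 i hi))]
      rw [e1, e2]
      ring

lemma cumul {n : ℕ} (ε : Equiv.Perm (Fin n) →* ℝ) (G : Matrix (Fin n) (Fin n) ℝ)
    (A : Finset (Fin n)) :
    ∑ π ∈ finsetPartitions A, muC π.card * ∏ B ∈ π, FF ε G B =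
      ∑ σ ∈ Finset.univ.filter (fun σ : Equiv.Perm (Fin n) => ∀ x, x ∉ A → σ x = x),
        if (∀ x ∈ A, ∀ y ∈ A, σ.SameCycle x y) then ε σ * ∏ i ∈ A, G i (σ i) else 0 := by
  have h1 : ∀ π ∈ finsetPartitions A, muC π.card * ∏ B ∈ π, FF ε G B =
      ∑ σ ∈ Finset.univ.filter (fun σ : Equiv.Perm (Fin n) => ∀ x, x ∉ A → σ x = x),
        if (∀ B ∈ π, ∀ x ∈ B, σ x ∈ B) then muC π.card * (ε σ * ∏ i ∈ A, G i (σ i)) else 0 := by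
    intro π hπ
    have h := (Finset.mem_filter.1 hπ).2
    rw [prod_FF ε G π h.2.1, h.2.2, ← Finset.sum_filter, Finset.filter_filter, Finset.mul_sum]
  rw [Finset.sum_congr rfl h1, Finset.sum_comm]
  refine Finset.sum_congr rfl fun σ hσ => ?_
  rw [← Finset.sum_filter, ← Finset.sum_mul, inner_cum_sum A σ (fix_inv (Finset.mem_filter.1 hσ).2)]
  split_ifs <;> simp

lemma sum_sub {n : ℕ} (A : Finset (Fin n)) (f : Equiv.Perm (Fin n) → ℝ) :
    ∑ σ ∈ Finset.univ.filter (fun σ : Equiv.Perm (Fin n) => ∀ x, x ∉ A → σ x = x), f σ =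
      ∑ τ : Equiv.Perm {x // x ∈ A}, f (Equiv.Perm.ofSubtype τ) := by
  symm
  refine Finset.sum_bij (fun τ _ => Equiv.Perm.ofSubtype τ) ?_ ?_ ?_ ?_
  · intro τ _
    rw [Finset.mem_filter]
    exact ⟨Finset.mem_univ _, fun x hx => Equiv.Perm.ofSubtype_apply_of_not_mem _ hx⟩
  · intro τ _ τ' _ h
    exact Equiv.Perm.ofSubtype_injective h
  · intro σ hσ
    have h := (Finset.mem_filter.1 hσ).2
    have hinv : ∀ x, σ x ∈ A ↔ x ∈ A := by
      intro x
      refine ⟨fun hx => ?_, fix_inv h x⟩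
      by_contra hn
      rw [h x hn] at hx
      exact hn hx
    refine ⟨σ.subtypePerm hinv, Finset.mem_univ _, ?_⟩
    refine Equiv.Perm.ofSubtype_subtypePerm hinv ?_
    intro x hx
    by_contra hn
    exact hx (h x hn)
  · intros; rfl

lemma prod_sub {n : ℕ} (A : Finset (Fin n)) (G : Matrix (Fin n) (Fin n) ℝ)
    (τ : Equiv.Perm {x // x ∈ A}) :
    ∏ i ∈ A, G i (Equiv.Perm.ofSubtype τ i) = ∏ i : {x // x ∈ A}, G i (τ i) := by
  rw [← Finset.prod_coe_sort]
  refine Finset.prod_congr rfl fun i _ => ?_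
  rw [Equiv.Perm.ofSubtype_apply_coe]

noncomputable def sgnR (n : ℕ) : Equiv.Perm (Fin n) →* ℝ :=
  ((Int.castRingHom ℝ : ℤ →* ℝ).comp (Units.coeHom ℤ)).comp Equiv.Perm.sign

lemma FF_one {n : ℕ} (G : Matrix (Fin n) (Fin n) ℝ) (B : Finset (Fin n)) :
    permanent (G.submatrix (fun a : {x // x ∈ B} => (a : Fin n))
        (fun a : {x // x ∈ B} => (a : Fin n))) = FF 1 G B := by
  rw [FF, sum_sub, permanent]
  refine Finset.sum_congr rfl fun τ _ => ?_
  rw [prod_sub]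
  simp

lemma FF_sgn {n : ℕ} (G : Matrix (Fin n) (Fin n) ℝ) (B : Finset (Fin n)) :
    (G.submatrix (fun a : {x // x ∈ B} => (a : Fin n))
        (fun a : {x // x ∈ B} => (a : Fin n))).det = FF (sgnR n) G B := by
  rw [FF, sum_sub, ← Matrix.det_transpose, Matrix.det_apply']
  refine Finset.sum_congr rfl fun τ _ => ?_
  rw [prod_sub]
  simp [sgnR]

lemma cyc_iff {n : ℕ} (A : Finset (Fin n)) (τ : Equiv.Perm {x // x ∈ A}) :
    (∀ x ∈ A, ∀ y ∈ A, (Equiv.Perm.ofSubtype τ).SameCycle x y) ↔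
      ∀ x y, ∃ m : ℕ, (τ ^ m) x = y := by
  have key : ∀ (m : ℕ) (x : {x // x ∈ A}), ((Equiv.Perm.ofSubtype τ) ^ m) (x : Fin n) =
      ((τ ^ m) x : {x // x ∈ A}) := by
    intro m x
    rw [← map_pow, Equiv.Perm.ofSubtype_apply_coe]
  constructor
  · rintro h ⟨x, hx⟩ ⟨y, hy⟩
    obtain ⟨m, -, hm⟩ := (h x hx y hy).exists_pow_eq'
    exact ⟨m, Subtype.ext (by rw [← key]; exact hm)⟩
  · intro h x hx y hy
    obtain ⟨m, hm⟩ := h ⟨x, hx⟩ ⟨y, hy⟩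
    refine ⟨m, ?_⟩
    rw [zpow_natCast]
    have := key m ⟨x, hx⟩
    rw [hm] at this
    exact this

lemma sign_cyc {n : ℕ} (A : Finset (Fin n)) (τ : Equiv.Perm {x // x ∈ A})
    (h : ∀ x y, ∃ m : ℕ, (τ ^ m) x = y) :
    sgnR n (Equiv.Perm.ofSubtype τ) = (-1) ^ (A.card - 1) := by
  have h0 : sgnR n (Equiv.Perm.ofSubtype τ) = ((Equiv.Perm.sign τ : ℤ) : ℝ) := by
    simp [sgnR]
  rw [h0]
  by_cases hA : A.card ≤ 1
  · have : Subsingleton {x // x ∈ A} := by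
      rw [← Fintype.card_le_one_iff_subsingleton]
      simpa using hA
    have h1 : τ = 1 := Subsingleton.elim _ _
    have h2 : A.card - 1 = 0 := by omega
    rw [h1, h2]
    simp
  · have : Nontrivial {x // x ∈ A} := by
      rw [← Fintype.one_lt_card_iff_nontrivial]
      simpa using hA
    have hm : ∀ x, τ x ≠ x := by
      intro x hx
      obtain ⟨y, hy⟩ := exists_ne x
      obtain ⟨m, hm⟩ := h x y
      rw [Equiv.Perm.pow_apply_eq_self_of_apply_eq_self hx] at hm
      exact hy hm.symm
    have hcyc : τ.IsCycle := by
      obtain ⟨x⟩ : Nonempty {x // x ∈ A} := inferInstance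
      refine ⟨x, hm x, fun y _ => ?_⟩
      obtain ⟨m, hm⟩ := h x y
      exact ⟨m, by rw [zpow_natCast]; exact hm⟩
    have hs : τ.support = Finset.univ := by
      ext x
      simp [hm x]
    have hc : A.card = (A.card - 1) + 1 := by omega
    rw [hcyc.sign, hs, Finset.card_univ, Fintype.card_coe]
    conv_lhs => rw [hc]
    rw [pow_succ]
    simp

lemma cumul' {n : ℕ} (ε : Equiv.Perm (Fin n) →* ℝ) (G : Matrix (Fin n) (Fin n) ℝ)
    (A : Finset (Fin n)) :
    ∑ π ∈ finsetPartitions A, muC π.card * ∏ B ∈ π, FF ε G B =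
      ∑ σ ∈ Finset.univ.filter (fun σ : Equiv.Perm {x // x ∈ A} =>
          ∀ x y, ∃ m : ℕ, (σ ^ m) x = y),
        ε (Equiv.Perm.ofSubtype σ) * ∏ i : {x // x ∈ A}, G i (σ i) := by
  rw [cumul, sum_sub, Finset.sum_filter]
  refine Finset.sum_congr rfl fun τ _ => ?_
  rw [prod_sub]
  simp only [cyc_iff]

/-- **Permanent–determinant cumulant identity**: for a symmetric matrix `G`,
`k_perm(A) = (-1)^{|A|-1} k_det(A)`, and `k_perm(A)` is the sum over cyclic
permutations of `A` of `∏_{i∈A} G(i, σ i)`. -/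
theorem permanent_determinant_cumulant {n : ℕ} (G : Matrix (Fin n) (Fin n) ℝ)
    (hGsym : G.IsSymm) (A : Finset (Fin n)) :
    (kPerm G A = (-1 : ℝ) ^ (A.card - 1) * kDet G A) ∧
    (kPerm G A =
      ∑ σ ∈ Finset.univ.filter (fun σ : Equiv.Perm {x // x ∈ A} =>
          ∀ x y, ∃ m : ℕ, (σ ^ m) x = y),
        ∏ i : {x // x ∈ A}, G i (σ i)) := by
  have hP : kPerm G A = ∑ σ ∈ Finset.univ.filter (fun σ : Equiv.Perm {x // x ∈ A} =>
          ∀ x y, ∃ m : ℕ, (σ ^ m) x = y),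
        ∏ i : {x // x ∈ A}, G i (σ i) := by
    have := cumul' 1 G A
    simp only [MonoidHom.one_apply, one_mul] at this
    rw [← this, kPerm]
    simp only [FF_one, muC]
  have hD : kDet G A = (-1 : ℝ) ^ (A.card - 1) *
      ∑ σ ∈ Finset.univ.filter (fun σ : Equiv.Perm {x // x ∈ A} =>
          ∀ x y, ∃ m : ℕ, (σ ^ m) x = y),
        ∏ i : {x // x ∈ A}, G i (σ i) := by
    have := cumul' (sgnR n) G A
    rw [Finset.mul_sum, kDet]
    simp only [FF_sgn]
    refine this.trans (Finset.sum_congr rfl fun τ hτ => ?_)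
    rw [sign_cyc A τ (Finset.mem_filter.1 hτ).2]
  refine ⟨?_, hP⟩
  rw [hD, hP, ← mul_assoc, ← mul_pow]
  simp
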